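/- arXiv:2407.03710 — 6 statements merged into one kernel-verified Lean document; each statement's English description precedes it below -/
import Mathlib

section
/- Let 𝕕 ≥ 1 and N ≥ 1 be integers, let ε ∈ {−1,+1}^𝕕, and let D ∈ ℤ^𝕕 satisfy ε_i·D_i ≥ 0 for all i and 1 ≤ ‖D‖₁ ≤ N. Then the number of sequences (m_1, …, m_N) ∈ {1,…,𝕕}^N such that γ_t = D for some 1 ≤ t ≤ N (i.e. the associated path passes through D) is exactly (‖D‖₁)! / (|D_1|! ⋯ |D_𝕕|!) · 𝕕^{N − ‖D‖₁}. -/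
open Finset

theorem card_fiber_eq_multinomial (d n : ℕ) (k : Fin d → ℕ) (hk : ∑ i, k i = n) :
    (Finset.univ.filter (fun m : Fin n → Fin d =>
      ∀ i, (Finset.univ.filter (fun j => m j = i)).card = k i)).card
      = Nat.multinomial Finset.univ k := by
  classical
  have h := MvPolynomial.coeff_sum_X_pow_of_fintype (R := ℕ) (Finsupp.equivFunOnFinite.symm k) n
  have hs : (Finsupp.equivFunOnFinite.symm k).sum (fun _ m ↦ m) = n := by
    rw [Finsupp.sum_fintype _ _ (fun _ => rfl)]
    simpa using hk
  rw [if_pos hs, Finsupp.multinomial_eq_of_support_subset (Finset.subset_univ _)] at h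
  simp only [Finsupp.coe_equivFunOnFinite_symm, Nat.cast_id] at h
  rw [← h, Finset.sum_pow', MvPolynomial.coeff_sum, Finset.card_filter, Fintype.piFinset_univ]
  refine Finset.sum_congr rfl fun m _ => ?_
  simp only [MvPolynomial.X]
  rw [← MvPolynomial.monomial_sum_one, MvPolynomial.coeff_monomial]
  congr 1
  rw [eq_iff_iff, Finsupp.ext_iff]
  refine forall_congr' fun i => ?_
  rw [Finsupp.finsetSum_apply, Finset.card_filter]
  simp [Finsupp.single_apply]

theorem card_prefix (d n r : ℕ) (P : (Fin n → Fin d) → Prop) [DecidablePred P] :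
    (Finset.univ.filter (fun m : Fin (n + r) → Fin d =>
      P (fun j => m (Fin.castAdd r j)))).card
      = (Finset.univ.filter P).card * d ^ r := by
  classical
  have h2 : d ^ r = (Finset.univ : Finset (Fin r → Fin d)).card := by simp
  rw [h2, ← Finset.card_product]
  symm
  refine Finset.card_equiv (Fin.appendEquiv n r) ?_
  rintro ⟨a, b⟩
  simp [Fin.appendEquiv]

theorem visit_iff (d n r : ℕ) (hn : 1 ≤ n) (ε : Fin d → ℤ) (hε : ∀ i, ε i = 1 ∨ ε i = -1)
    (D : Fin d → ℤ) (hsign : ∀ i, 0 ≤ ε i * D i) (hD : ∑ i, (D i).natAbs = n)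
    (m : Fin (n + r) → Fin d) :
    (∃ t : Fin (n + r), ∀ i,
          (∑ j ∈ Finset.univ.filter (fun j : Fin (n + r) => j ≤ t),
            if m j = i then ε i else 0) = D i) ↔
    ∀ i, (Finset.univ.filter (fun j : Fin n => m (Fin.castAdd r j) = i)).card
      = (D i).natAbs := by
  have key : ∀ (t : Fin (n + r)) i, (∑ j ∈ Finset.univ.filter (fun j : Fin (n + r) => j ≤ t),
            if m j = i then ε i else 0) = D i ↔
      ((Finset.univ.filter (fun j : Fin (n + r) => j ≤ t)).filter (fun j => m j = i)).card
        = (D i).natAbs := by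
    intro t i
    rw [← Finset.sum_filter, Finset.sum_const, nsmul_eq_mul]
    have := hsign i
    rcases hε i with h | h <;> rw [h] at this ⊢ <;> omega
  simp only [key]
  have hcard : ∀ t : Fin (n + r), t.val + 1 = n → ∀ i,
      ((Finset.univ.filter (fun j : Fin (n + r) => j ≤ t)).filter (fun j => m j = i)).card
      = (Finset.univ.filter (fun j : Fin n => m (Fin.castAdd r j) = i)).card := by
    intro t ht i
    symm
    refine Finset.card_bij (fun j _ => Fin.castAdd r j) ?_ ?_ ?_
    · intro a ha
      simp only [Finset.mem_filter, Finset.mem_univ, true_and] at ha ⊢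
      refine ⟨?_, ha⟩
      rw [Fin.le_def, Fin.val_castAdd]
      omega
    · intro a _ b _ hab
      exact Fin.castAdd_injective _ _ hab
    · intro b hb
      simp only [Finset.mem_filter, Finset.mem_univ, true_and, Fin.le_def] at hb
      exact ⟨⟨b.val, by omega⟩, by simpa using hb.2, by ext; simp⟩
  constructor
  · rintro ⟨t, ht⟩ i
    rw [← hcard t _ i, ht i]
    have h1 := Finset.card_eq_sum_card_fiberwise (f := m)
      (s := Finset.univ.filter (fun j : Fin (n + r) => j ≤ t)) (t := Finset.univ) (by simp)
    rw [Finset.sum_congr rfl (fun i _ => ht i), hD] at h1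
    rwa [Finset.filter_ge_eq_Iic, Fin.card_Iic] at h1
  · intro h
    refine ⟨⟨n - 1, by omega⟩, fun i => ?_⟩
    rw [hcard _ (by simp; omega), h i]



/-- **Lemma 2.1 (path counting).**  Let `𝕕, N ≥ 1`, let `ε ∈ {−1,+1}^𝕕` be a sign vector,
and let `D ∈ ℤ^𝕕` lie in the orthant determined by `ε` with `1 ≤ ‖D‖₁ ≤ N`.  A path of
distance `N` is a sequence of moves `m : Fin N → Fin 𝕕`, the `j`-th move adding
`ε (m j) • e (m j)`; it visits the partial sums `γ t = ∑_{j ≤ t} ε (m j) e (m j)`.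
The number of such paths passing through `D` is
`(‖D‖₁)! / (|D 1|! ⋯ |D 𝕕|!) · 𝕕 ^ (N − ‖D‖₁)`. -/
theorem path_count (𝕕 N : ℕ) (h𝕕 : 1 ≤ 𝕕) (hN : 1 ≤ N)
    (ε : Fin 𝕕 → ℤ) (hε : ∀ i, ε i = 1 ∨ ε i = -1)
    (D : Fin 𝕕 → ℤ) (hsign : ∀ i, 0 ≤ ε i * D i)
    (hD1 : 1 ≤ ∑ i, (D i).natAbs) (hDN : ∑ i, (D i).natAbs ≤ N) :
    (Finset.univ.filter (fun m : Fin N → Fin 𝕕 =>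
        ∃ t : Fin N, ∀ i,
          (∑ j ∈ Finset.univ.filter (fun j : Fin N => j ≤ t),
            if m j = i then ε i else 0) = D i)).card
      = Nat.multinomial Finset.univ (fun i => (D i).natAbs)
          * 𝕕 ^ (N - ∑ i, (D i).natAbs) := by
  generalize hn : ∑ i, (D i).natAbs = n at hD1 hDN ⊢
  obtain ⟨r, rfl⟩ := Nat.exists_eq_add_of_le hDN
  rw [Nat.add_sub_cancel_left, ← card_fiber_eq_multinomial 𝕕 n _ hn, ← card_prefix]
  congr 1
  ext m
  simp only [Finset.mem_filter, Finset.mem_univ, true_and]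
  exact visit_iff 𝕕 n r hD1 ε hε D hsign hn m
end

section
/- Under the stated assumptions on σ and M, there exists a constant C > 0 such that |K̂_M(k,k')| ≤ C·ω(k) for all k, k' ∈ [−1/2, 1/2]; in particular sup_{k,k'} |K̂_M(k,k')/ω(k)| < ∞. -/
open Finset Real

noncomputable def Sig (N : ℕ) (M : ℤ → ℝ) (d : ℤ) : ℝ :=
  ∑ d₁ ∈ Finset.Icc (-(N:ℤ)) N, ∑ d₂ ∈ Finset.Icc (-(N:ℤ)) N,
    if d₁ + d₂ = d ∧ d₁ ≠ 0 ∧ d₂ ≠ 0 then M d₁ * M d₂ else 0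

/-- The kernel coefficients `K_M(d,d')`. -/
noncomputable def Kcoef (N : ℕ) (M : ℤ → ℝ) (d d' : ℤ) : ℝ :=
  if d = 0 ∧ d' = 0 then 3 * ∑ j ∈ Finset.Icc (1:ℤ) N, M j ^ 2
  else if 1 ≤ |d| ∧ |d| ≤ (N:ℤ) ∧ d' = 0 then -(M d ^ 2) - (1/2) * Sig N M d
  else if 1 ≤ |d'| ∧ |d'| ≤ (N:ℤ) ∧ d = 0 then -(M d' ^ 2) - (1/2) * Sig N M d'
  else if (N:ℤ) + 1 ≤ |d| ∧ |d| ≤ 2*(N:ℤ) ∧ d' = 0 then -(1/2) * Sig N M d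
  else if (N:ℤ) + 1 ≤ |d'| ∧ |d'| ≤ 2*(N:ℤ) ∧ d = 0 then -(1/2) * Sig N M d'
  else if (d' = d ∨ d' = -d) ∧ 1 ≤ |d| ∧ |d| ≤ 2*(N:ℤ) then
    if 2*|d| ≤ (N:ℤ) then -(1/4) * Sig N M d - M d * M (2*d)
    else -(1/4) * Sig N M d
  else if 1 ≤ |d| ∧ |d| ≤ (N:ℤ) ∧ (N:ℤ) < |d'| ∧ |d'| ≤ 2*(N:ℤ) then
    if |d' - d| ≤ (N:ℤ) then (1/2) * (M d * M (d' - d))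
    else if |d' + d| ≤ (N:ℤ) then -(1/2) * (M d * M (d' + d))
    else 0
  else if 1 ≤ |d'| ∧ |d'| ≤ (N:ℤ) ∧ (N:ℤ) < |d| ∧ |d| ≤ 2*(N:ℤ) then
    if |d - d'| ≤ (N:ℤ) then (1/2) * (M d' * M (d - d'))
    else if |d + d'| ≤ (N:ℤ) then -(1/2) * (M d' * M (d + d'))
    else 0
  else if 1 ≤ |d| ∧ |d| ≤ (N:ℤ) ∧ 1 ≤ |d'| ∧ |d'| ≤ (N:ℤ) then
    if |d - d'| ≤ (N:ℤ) ∧ |d + d'| ≤ (N:ℤ) then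
      (1/2) * (M d' * M (d - d') + M d * M (d' - d)
        - M d' * M (d + d') - M d * M (d + d'))
    else if |d - d'| ≤ (N:ℤ) ∧ (N:ℤ) < |d + d'| then
      (1/2) * (M d' * M (d - d') + M d * M (d' - d))
    else if |d + d'| ≤ (N:ℤ) ∧ (N:ℤ) < |d - d'| then
      -(1/2) * (M d' * M (d + d') + M d * M (d + d'))
    else 0
  else 0

/-- The controlled kernel `K̂_M(k,k')`. -/
noncomputable def Khat (N : ℕ) (M : ℤ → ℝ) (k k' : ℝ) : ℝ :=
  ∑ d ∈ Finset.Icc (-(2*(N:ℤ))) (2*(N:ℤ)), ∑ d' ∈ Finset.Icc (-(2*(N:ℤ))) (2*(N:ℤ)),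
    Kcoef N M d d' * Real.cos (2*π*d*k) * Real.cos (2*π*d'*k')

lemma aux_vanish (N : ℕ) (M : ℤ → ℝ) (hM2 : ∀ d : ℤ, (2*|d| ≤ (N:ℤ) ∨ (N:ℤ) < |d|) → M d = 0)
    (d : ℤ) (h : d ∉ Finset.Icc (-(N:ℤ)) N) : M d = 0 := by
  apply hM2; right
  by_contra hc
  exact h (Finset.mem_Icc.2 (abs_le.1 (not_lt.1 hc)))

lemma aux_zero (N : ℕ) (M : ℤ → ℝ) (hM2 : ∀ d : ℤ, (2*|d| ≤ (N:ℤ) ∨ (N:ℤ) < |d|) → M d = 0) :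
    M 0 = 0 := hM2 0 (by simp)

lemma aux_sum_zero (N : ℕ) (M : ℤ → ℝ) (hM1 : ∀ d : ℤ, M d + M (-d) = 0) :
    ∑ d ∈ Finset.Icc (-(N:ℤ)) N, M d = 0 := by
  have h : ∑ d ∈ Finset.Icc (-(N:ℤ)) N, M d = ∑ d ∈ Finset.Icc (-(N:ℤ)) N, M (-d) := by
    apply Finset.sum_nbij' (fun d => -d) (fun d => -d) <;> intro a ha <;>
      simp only [Finset.mem_Icc, neg_neg] at * <;> omega
  have h2 : ∑ d ∈ Finset.Icc (-(N:ℤ)) N, (M d + M (-d)) = 0 :=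
    Finset.sum_eq_zero (fun d _ => hM1 d)
  rw [Finset.sum_add_distrib] at h2
  linarith

lemma aux_shift (N : ℕ) (f : ℤ → ℝ) (hf : ∀ d, d ∉ Finset.Icc (-(N:ℤ)) N → f d = 0)
    (c : ℤ) (hc : |c| ≤ (N:ℤ)) :
    ∑ d ∈ Finset.Icc (-(2*(N:ℤ))) (2*(N:ℤ)), f (d - c) = ∑ d ∈ Finset.Icc (-(N:ℤ)) N, f d := by
  have hc' := abs_le.1 hc
  have h : ∑ d ∈ Finset.Icc (-(N:ℤ)) N, f d = ∑ d ∈ Finset.Icc (-(N:ℤ)+c) (N+c), f (d-c) := by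
    apply Finset.sum_nbij' (fun d => d + c) (fun d => d - c) <;> intro a ha <;>
      simp only [Finset.mem_Icc, add_sub_cancel_right, sub_add_cancel] at * <;> omega
  rw [h]
  symm
  apply Finset.sum_subset
  · intro x; simp only [Finset.mem_Icc]; omega
  · intro x _ hx
    apply hf
    simp only [Finset.mem_Icc] at *; omega

lemma aux_big (N : ℕ) (f : ℤ → ℝ) (hf : ∀ d, d ∉ Finset.Icc (-(N:ℤ)) N → f d = 0) :
    ∑ d ∈ Finset.Icc (-(2*(N:ℤ))) (2*(N:ℤ)), f d = ∑ d ∈ Finset.Icc (-(N:ℤ)) N, f d := by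
  simpa using aux_shift N f hf 0 (by simp)

lemma aux_Sig (N : ℕ) (M : ℤ → ℝ)
    (hM2 : ∀ d : ℤ, (2*|d| ≤ (N:ℤ) ∨ (N:ℤ) < |d|) → M d = 0) (d : ℤ) :
    Sig N M d = ∑ j ∈ Finset.Icc (-(N:ℤ)) N, M j * M (d - j) := by
  unfold Sig
  apply Finset.sum_congr rfl
  intro j _
  have h0 := aux_zero N M hM2
  have h1 : ∀ i ∈ Finset.Icc (-(N:ℤ)) N,
      (if j + i = d ∧ j ≠ 0 ∧ i ≠ 0 then M j * M i else 0)
        = if i = d - j then M j * M (d - j) else 0 := by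
    intro i _
    by_cases hi : i = d - j
    · subst hi
      rw [if_pos rfl]
      split_ifs with h
      · rfl
      · by_cases hj : j = 0
        · rw [hj, h0]; ring
        · by_cases hk : d - j = 0
          · rw [hk, h0]; ring
          · exact absurd ⟨by ring, hj, hk⟩ h
    · rw [if_neg hi, if_neg]
      rintro ⟨h, -⟩; omega
  rw [Finset.sum_congr rfl h1, Finset.sum_ite_eq']
  split_ifs with h
  · rfl
  · rw [aux_vanish N M hM2 _ h]; ring

lemma aux_Sig_neg (N : ℕ) (M : ℤ → ℝ) (hM1 : ∀ d : ℤ, M d + M (-d) = 0)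
    (hM2 : ∀ d : ℤ, (2*|d| ≤ (N:ℤ) ∨ (N:ℤ) < |d|) → M d = 0) (d : ℤ) :
    Sig N M (-d) = Sig N M d := by
  rw [aux_Sig N M hM2, aux_Sig N M hM2]
  apply Finset.sum_nbij' (fun d => -d) (fun d => -d)
  · intro a ha; simp only [Finset.mem_Icc] at *; omega
  · intro a ha; simp only [Finset.mem_Icc] at *; omega
  · intro a _; simp
  · intro a _; simp
  · intro a _
    have h1 := hM1 a
    have h2 := hM1 (-d - a)
    rw [show -(-d - a) = d - -a by ring] at h2
    rw [show M (-d - a) = - M (d - -a) by linarith, show M a = - M (-a) by linarith]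
    ring

/-- generic off-diagonal expression -/
noncomputable def Gaux (M : ℤ → ℝ) (d d' : ℤ) : ℝ :=
  (1/2) * (M d' * (M (d - d') - M (d + d')) + M d * (M (d' - d) - M (d + d')))

lemma aux_double (N : ℕ) (M : ℤ → ℝ)
    (hM2 : ∀ d : ℤ, (2*|d| ≤ (N:ℤ) ∨ (N:ℤ) < |d|) → M d = 0) (d : ℤ) : M d * M (2*d) = 0 := by
  by_cases h : 2*|d| ≤ (N:ℤ)
  · rw [hM2 d (Or.inl h)]; ring
  · rw [hM2 (2*d) (Or.inr (by rw [abs_mul]; simpa using h))]; ring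

lemma aux_K (N : ℕ) (M : ℤ → ℝ) (hM1 : ∀ d : ℤ, M d + M (-d) = 0)
    (hM2 : ∀ d : ℤ, (2*|d| ≤ (N:ℤ) ∨ (N:ℤ) < |d|) → M d = 0) (d d' : ℤ) (hd' : d' ≠ 0)
    (h1 : |d| ≤ 2*(N:ℤ)) (h2 : |d'| ≤ 2*(N:ℤ)) :
    Kcoef N M d d' = Gaux M d d' - (if d = 0 then (1/2) * Sig N M d' else 0)
      - (if d = d' then (1/4) * Sig N M d' else 0)
      - (if d = -d' then (1/4) * Sig N M d' else 0) := by
  have h0 := aux_zero N M hM2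
  have hp : 1 ≤ |d'| := Int.one_le_abs hd'
  have hv : ∀ x : ℤ, (N:ℤ) < |x| → M x = 0 := fun x hx => hM2 x (Or.inr hx)
  have hneg : ∀ x, M (-x) = - M x := fun x => by linarith [hM1 x]
  by_cases hd : d = 0
  · subst hd
    have e : Gaux M 0 d' = - (M d')^2 := by
      unfold Gaux; simp only [zero_sub, sub_zero, zero_add, hneg, h0]; ring
    have n1 : ¬ ((0:ℤ) = d') := fun h => hd' h.symm
    have n2 : ¬ ((0:ℤ) = -d') := by omega
    rw [e, if_pos rfl, if_neg n1, if_neg n2]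
    unfold Kcoef
    by_cases hN' : |d'| ≤ (N:ℤ)
    · simp [hd', hp, hN']
    · have : M d' = 0 := hv d' (by omega)
      have g : (N:ℤ) + 1 ≤ |d'| := by omega
      simp [hd', hN', this, g, h2]
  have hq : 1 ≤ |d| := Int.one_le_abs hd
  rw [if_neg hd]
  by_cases hdd : d' = d ∨ d' = -d
  · have hS : Sig N M d' = Sig N M d := by
      rcases hdd with h | h
      · rw [h]
      · rw [h, aux_Sig_neg N M hM1 hM2]
    have hG : Gaux M d d' = 0 := by
      have := aux_double N M hM2 d
      rcases hdd with h | h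
      · subst h
        unfold Gaux
        rw [sub_self, h0, ← two_mul d']; linarith
      · subst h
        unfold Gaux
        rw [sub_neg_eq_add, add_neg_cancel, h0, ← two_mul d, show -d - d = -(2*d) by ring,
          hneg, hneg]; linarith
    have hone : (if d = d' then (1/4) * Sig N M d' else 0) + (if d = -d' then (1/4) * Sig N M d' else 0)
        = (1/4) * Sig N M d := by
      rw [hS]
      rcases hdd with h | h
      · rw [if_pos h.symm, if_neg (by omega)]; ring
      · rw [if_neg (by omega), if_pos (by omega)]; ring
    have hK : Kcoef N M d d' = -(1/4) * Sig N M d := by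
      unfold Kcoef
      rw [if_neg (by tauto), if_neg (by tauto), if_neg (by tauto), if_neg (by tauto),
        if_neg (by tauto), if_pos ⟨hdd, hq, h1⟩, aux_double N M hM2]
      split_ifs <;> ring
    rw [hK, hG]; linarith
  have m1 : ¬ d = d' := fun h => hdd (Or.inl h.symm)
  have m2 : ¬ d = -d' := by intro h; apply hdd; right; omega
  rw [if_neg m1, if_neg m2]
  unfold Kcoef
  rw [if_neg (by tauto), if_neg (by tauto), if_neg (by tauto), if_neg (by tauto),
        if_neg (by tauto), if_neg (by tauto)]
  have hsym : |d - d'| = |d' - d| := abs_sub_comm _ _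
  have hsym2 : d' + d = d + d' := add_comm _ _
  have hsym3 : M (d - d') = - M (d' - d) := by rw [← hneg]; congr 1; ring
  unfold Gaux
  by_cases c1 : |d| ≤ (N:ℤ) <;> by_cases c2 : |d'| ≤ (N:ℤ)
  · rw [if_neg (by omega), if_neg (by omega), if_pos ⟨hq, c1, hp, c2⟩]
    by_cases c3 : |d - d'| ≤ (N:ℤ) <;> by_cases c4 : |d + d'| ≤ (N:ℤ)
    · rw [if_pos ⟨c3, c4⟩]; ring
    · rw [if_neg (by omega), if_pos ⟨c3, by omega⟩, hv (d + d') (by omega)]; ring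
    · rw [if_neg (by omega), if_neg (by omega), if_pos ⟨c4, by omega⟩, hsym3,
        hv (d' - d) (by omega)]; ring
    · rw [if_neg (by omega), if_neg (by omega), if_neg (by omega), hsym3,
        hv (d' - d) (by omega), hv (d + d') (by omega)]; ring
  · rw [if_pos ⟨hq, c1, by omega, h2⟩, hv d' (by omega), hsym2]
    have : (N:ℤ) < |d' - d| ∨ (N:ℤ) < |d + d'| := by
      rw [lt_abs, lt_abs]; have := lt_abs.1 (not_le.1 c2); omega
    split_ifs with c3 c4
    · rw [hv (d + d') (by omega)]; ring
    · rw [hv (d' - d) (by omega)]; ring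
    · rw [hv (d' - d) (by omega), hv (d + d') (by omega)]; ring
  · rw [if_neg (by omega), if_pos ⟨hp, c2, by omega, h1⟩, hv d (by omega)]
    have : (N:ℤ) < |d - d'| ∨ (N:ℤ) < |d + d'| := by
      rw [lt_abs, lt_abs]; have := lt_abs.1 (not_le.1 c1); omega
    split_ifs with c3 c4
    · rw [hv (d + d') (by omega)]; ring
    · rw [hv (d - d') (by omega)]; ring
    · rw [hv (d - d') (by omega), hv (d + d') (by omega)]; ring
  · rw [if_neg (by omega), if_neg (by omega), if_neg (by omega), hv d (by omega), hv d' (by omega)]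
    ring

lemma aux_conv (N : ℕ) (M : ℤ → ℝ)
    (hM2 : ∀ d : ℤ, (2*|d| ≤ (N:ℤ) ∨ (N:ℤ) < |d|) → M d = 0) (d' : ℤ) :
    ∑ d ∈ Finset.Icc (-(2*(N:ℤ))) (2*(N:ℤ)), M d * M (d' - d) = Sig N M d' := by
  rw [aux_Sig N M hM2]
  exact aux_big N (fun d => M d * M (d' - d)) (fun d hd => by
    simp only [aux_vanish N M hM2 d hd]; ring)

lemma aux_conv2 (N : ℕ) (M : ℤ → ℝ) (hM1 : ∀ d : ℤ, M d + M (-d) = 0)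
    (hM2 : ∀ d : ℤ, (2*|d| ≤ (N:ℤ) ∨ (N:ℤ) < |d|) → M d = 0) (d' : ℤ) :
    ∑ d ∈ Finset.Icc (-(2*(N:ℤ))) (2*(N:ℤ)), M d * M (d + d') = - Sig N M d' := by
  rw [← aux_conv N M hM2, ← Finset.sum_neg_distrib]
  apply Finset.sum_nbij' (fun d => -d) (fun d => -d)
  · intro a ha; simp only [Finset.mem_Icc] at *; omega
  · intro a ha; simp only [Finset.mem_Icc] at *; omega
  · intro a _; simp
  · intro a _; simp
  · intro a _
    rw [show d' - -a = a + d' by ring, show M (-a) = - M a by linarith [hM1 a]]; ring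

lemma aux_colsum_ne (N : ℕ) (M : ℤ → ℝ) (hM1 : ∀ d : ℤ, M d + M (-d) = 0)
    (hM2 : ∀ d : ℤ, (2*|d| ≤ (N:ℤ) ∨ (N:ℤ) < |d|) → M d = 0) (d' : ℤ) (hd' : d' ≠ 0)
    (h2 : |d'| ≤ 2*(N:ℤ)) :
    ∑ d ∈ Finset.Icc (-(2*(N:ℤ))) (2*(N:ℤ)), Kcoef N M d d' = 0 := by
  rw [Finset.sum_congr rfl (fun d hd => aux_K N M hM1 hM2 d d' hd'
    (abs_le.2 (Finset.mem_Icc.1 hd)) h2)]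
  have hm := abs_le.1 h2
  rw [Finset.sum_sub_distrib, Finset.sum_sub_distrib, Finset.sum_sub_distrib,
    Finset.sum_ite_eq', Finset.sum_ite_eq', Finset.sum_ite_eq',
    if_pos (Finset.mem_Icc.2 (by omega)), if_pos (Finset.mem_Icc.2 (by omega)),
    if_pos (Finset.mem_Icc.2 (by omega))]
  unfold Gaux
  rw [← Finset.mul_sum, Finset.sum_add_distrib, ← Finset.mul_sum, Finset.sum_sub_distrib]
  have e1 : ∑ d ∈ Finset.Icc (-(2*(N:ℤ))) (2*(N:ℤ)), M d * (M (d' - d) - M (d + d'))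
      = 2 * Sig N M d' := by
    simp only [mul_sub]
    rw [Finset.sum_sub_distrib, aux_conv N M hM2, aux_conv2 N M hM1 hM2]; ring
  rw [e1]
  by_cases c : |d'| ≤ (N:ℤ)
  · have a1 := aux_shift N M (aux_vanish N M hM2) d' c
    have a2 := aux_shift N M (aux_vanish N M hM2) (-d') (by rwa [abs_neg])
    simp only [sub_neg_eq_add] at a2
    rw [a1, a2]; ring
  · rw [hM2 d' (Or.inr (not_le.1 c))]; ring

lemma aux_Sig_zero (N : ℕ) (M : ℤ → ℝ) (hM1 : ∀ d : ℤ, M d + M (-d) = 0)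
    (hM2 : ∀ d : ℤ, (2*|d| ≤ (N:ℤ) ∨ (N:ℤ) < |d|) → M d = 0) :
    Sig N M 0 = - ∑ d ∈ Finset.Icc (-(N:ℤ)) N, M d ^ 2 := by
  rw [aux_Sig N M hM2, ← Finset.sum_neg_distrib]
  apply Finset.sum_congr rfl
  intro j _
  rw [zero_sub, show M (-j) = - M j by linarith [hM1 j]]; ring

lemma aux_sq (N : ℕ) (M : ℤ → ℝ) (hM1 : ∀ d : ℤ, M d + M (-d) = 0)
    (hM2 : ∀ d : ℤ, (2*|d| ≤ (N:ℤ) ∨ (N:ℤ) < |d|) → M d = 0) :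
    ∑ d ∈ Finset.Icc (-(N:ℤ)) N, M d ^ 2 = 2 * ∑ d ∈ Finset.Icc (1:ℤ) N, M d ^ 2 := by
  have hs : Finset.Icc (-(N:ℤ)) N = (Finset.Icc (-(N:ℤ)) (-1) ∪ {0}) ∪ Finset.Icc (1:ℤ) N := by
    ext x; simp only [Finset.mem_Icc, Finset.mem_union, Finset.mem_singleton]; omega
  rw [hs, Finset.sum_union, Finset.sum_union, Finset.sum_singleton, aux_zero N M hM2]
  · have : ∑ d ∈ Finset.Icc (-(N:ℤ)) (-1), M d ^ 2 = ∑ d ∈ Finset.Icc (1:ℤ) N, M d ^ 2 := by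
      apply Finset.sum_nbij' (fun d => -d) (fun d => -d)
      · intro a ha; simp only [Finset.mem_Icc] at *; omega
      · intro a ha; simp only [Finset.mem_Icc] at *; omega
      · intro a _; simp
      · intro a _; simp
      · intro a _
        rw [show M (-a) = - M a by linarith [hM1 a]]; ring
    rw [this]; ring
  · rw [Finset.disjoint_left]; intro a ha; simp only [Finset.mem_Icc, Finset.mem_singleton] at *; omega
  · rw [Finset.disjoint_left]; intro a ha
    simp only [Finset.mem_Icc, Finset.mem_singleton, Finset.mem_union] at *; omega

lemma aux_colsum_zero (N : ℕ) (M : ℤ → ℝ) (hM1 : ∀ d : ℤ, M d + M (-d) = 0)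
    (hM2 : ∀ d : ℤ, (2*|d| ≤ (N:ℤ) ∨ (N:ℤ) < |d|) → M d = 0) :
    ∑ d ∈ Finset.Icc (-(2*(N:ℤ))) (2*(N:ℤ)), Kcoef N M d 0 = 0 := by
  have h0 := aux_zero N M hM2
  have hS0 := aux_Sig_zero N M hM1 hM2
  have hsq := aux_sq N M hM1 hM2
  have key : ∀ d ∈ Finset.Icc (-(2*(N:ℤ))) (2*(N:ℤ)), Kcoef N M d 0
      = (-(M d ^ 2) - (1/2) * Sig N M d)
        + if d = 0 then 2 * ∑ j ∈ Finset.Icc (1:ℤ) N, M j ^ 2 else 0 := by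
    intro d hd
    have hd' := abs_le.2 (Finset.mem_Icc.1 hd)
    by_cases h : d = 0
    · subst h
      rw [if_pos rfl, h0, hS0, hsq]
      unfold Kcoef
      rw [if_pos ⟨rfl, rfl⟩]; ring
    · have hq : 1 ≤ |d| := Int.one_le_abs h
      rw [if_neg h]
      unfold Kcoef
      by_cases c : |d| ≤ (N:ℤ)
      · rw [if_neg (by tauto), if_pos ⟨hq, c, rfl⟩]; ring
      · rw [if_neg (by tauto), if_neg (by tauto), if_neg (by tauto),
          if_pos ⟨by omega, hd', rfl⟩, hM2 d (Or.inr (not_le.1 c))]; ring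
  rw [Finset.sum_congr rfl key, Finset.sum_add_distrib, Finset.sum_ite_eq',
    if_pos (Finset.mem_Icc.2 (by omega)), Finset.sum_sub_distrib, Finset.sum_neg_distrib,
    ← Finset.mul_sum]
  have e1 := aux_big N (fun d => M d ^ 2) (fun d hd => by
    simp only [aux_vanish N M hM2 d hd]; ring)
  have e2 : ∑ d ∈ Finset.Icc (-(2*(N:ℤ))) (2*(N:ℤ)), Sig N M d = 0 := by
    simp only [aux_Sig N M hM2]
    rw [Finset.sum_comm]
    apply Finset.sum_eq_zero
    intro j hj
    rw [← Finset.mul_sum, aux_shift N M (aux_vanish N M hM2) j (abs_le.2 (Finset.mem_Icc.1 hj)),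
      aux_sum_zero N M hM1]; ring
  rw [e2, e1, hsq]; ring

lemma aux_colsum (N : ℕ) (M : ℤ → ℝ) (hM1 : ∀ d : ℤ, M d + M (-d) = 0)
    (hM2 : ∀ d : ℤ, (2*|d| ≤ (N:ℤ) ∨ (N:ℤ) < |d|) → M d = 0) (d' : ℤ)
    (h2 : |d'| ≤ 2*(N:ℤ)) :
    ∑ d ∈ Finset.Icc (-(2*(N:ℤ))) (2*(N:ℤ)), Kcoef N M d d' = 0 := by
  by_cases h : d' = 0
  · subst h; exact aux_colsum_zero N M hM1 hM2
  · exact aux_colsum_ne N M hM1 hM2 d' h h2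

lemma aux_Khat_eq (N : ℕ) (M : ℤ → ℝ) (hM1 : ∀ d : ℤ, M d + M (-d) = 0)
    (hM2 : ∀ d : ℤ, (2*|d| ≤ (N:ℤ) ∨ (N:ℤ) < |d|) → M d = 0) (k k' : ℝ) :
    Khat N M k k' = ∑ d ∈ Finset.Icc (-(2*(N:ℤ))) (2*(N:ℤ)),
      ∑ d' ∈ Finset.Icc (-(2*(N:ℤ))) (2*(N:ℤ)),
      Kcoef N M d d' * (Real.cos (2*π*d*k) - 1) * Real.cos (2*π*d'*k') := by
  have : ∑ d ∈ Finset.Icc (-(2*(N:ℤ))) (2*(N:ℤ)), ∑ d' ∈ Finset.Icc (-(2*(N:ℤ))) (2*(N:ℤ)),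
      Kcoef N M d d' * Real.cos (2*π*d'*k') = 0 := by
    rw [Finset.sum_comm]
    apply Finset.sum_eq_zero
    intro d' hd'
    rw [← Finset.sum_mul, aux_colsum N M hM1 hM2 d' (abs_le.2 (Finset.mem_Icc.1 hd')), zero_mul]
  unfold Khat
  rw [← sub_zero (∑ d ∈ _, _), ← this, ← Finset.sum_sub_distrib]
  apply Finset.sum_congr rfl
  intro d _
  rw [← Finset.sum_sub_distrib]
  apply Finset.sum_congr rfl
  intro d' _
  ring

lemma aux_Khat_bound (N : ℕ) (M : ℤ → ℝ) (hM1 : ∀ d : ℤ, M d + M (-d) = 0)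
    (hM2 : ∀ d : ℤ, (2*|d| ≤ (N:ℤ) ∨ (N:ℤ) < |d|) → M d = 0) :
    ∃ A : ℝ, 0 < A ∧ ∀ k k', |Khat N M k k'| ≤ A * |k| := by
  have hnn : 0 ≤ ∑ d ∈ Finset.Icc (-(2*(N:ℤ))) (2*(N:ℤ)),
      ∑ d' ∈ Finset.Icc (-(2*(N:ℤ))) (2*(N:ℤ)), |Kcoef N M d d'| * |2*π*d| :=
    Finset.sum_nonneg fun _ _ => Finset.sum_nonneg fun _ _ => by positivity
  refine ⟨∑ d ∈ Finset.Icc (-(2*(N:ℤ))) (2*(N:ℤ)),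
      ∑ d' ∈ Finset.Icc (-(2*(N:ℤ))) (2*(N:ℤ)), |Kcoef N M d d'| * |2*π*d| + 1,
      by linarith, fun k k' => ?_⟩
  have hk := abs_nonneg k
  refine le_trans ?_ (mul_le_mul_of_nonneg_right (le_add_of_nonneg_right zero_le_one) hk)
  rw [aux_Khat_eq N M hM1 hM2, Finset.sum_mul]
  refine (Finset.abs_sum_le_sum_abs _ _).trans (Finset.sum_le_sum fun d _ => ?_)
  rw [Finset.sum_mul]
  refine (Finset.abs_sum_le_sum_abs _ _).trans (Finset.sum_le_sum fun d' _ => ?_)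
  rw [abs_mul, abs_mul]
  have c1 : |Real.cos (2*π*d'*k')| ≤ 1 := Real.abs_cos_le_one _
  have c2 : |Real.cos (2*π*d*k) - 1| ≤ |2*π*d| * |k| := by
    rw [← abs_mul, abs_sub_comm]
    generalize 2*π*d*k = x
    have h1 : |1 - Real.cos x| = 1 - Real.cos x := abs_of_nonneg (by linarith [Real.cos_le_one x])
    rw [h1]
    by_cases hx : |x| ≤ 2
    · have := Real.one_sub_sq_div_two_le_cos (x := x)
      nlinarith [sq_abs x, abs_nonneg x]
    · linarith [Real.neg_one_le_cos x]
  calc _ ≤ |Kcoef N M d d'| * (|2*π*d| * |k|) * 1 := by gcongr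
    _ = _ := by ring

lemma aux_summ (σ : ℤ → ℝ) (C₁ C₂ : ℝ) (h2 : 0 < C₂) (p : ℕ) :
    Summable (fun n : ℤ => |(n:ℝ)|^p * (C₁ * Real.exp (-C₂ * |(n:ℝ)|))) := by
  have h := (Real.summable_pow_mul_exp_neg_nat_mul p h2).mul_left C₁
  apply Summable.of_nat_of_neg
  · refine h.congr fun n => ?_
    simp only [Int.cast_natCast, Nat.abs_cast]; ring
  · refine h.congr fun n => ?_
    simp only [Int.cast_neg, Int.cast_natCast, abs_neg, Nat.abs_cast]; ring

lemma aux_real (σ : ℤ → ℝ) (σhat : ℝ → ℝ)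
    (hσhat : ∀ k : ℝ, HasSum
      (fun n : ℤ => (σ n : ℂ) * Complex.exp (-(2*(π:ℂ)*Complex.I) * k * n))
      ((σhat k : ℂ))) (k : ℝ) :
    HasSum (fun n : ℤ => σ n * Real.cos (2*π*n*k)) (σhat k) := by
  have h := Complex.hasSum_re (hσhat k)
  rw [Complex.ofReal_re] at h
  refine h.congr_fun fun n => ?_
  rw [Complex.re_ofReal_mul, show (-(2*(π:ℂ)*Complex.I) * k * n) = ((-(2*π*n*k) : ℝ) : ℂ) * Complex.I by
    push_cast; ring, Complex.exp_ofReal_mul_I_re, Real.cos_neg]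

lemma aux_diff (σ : ℤ → ℝ) (σhat : ℝ → ℝ)
    (hσdecay : ∃ C₁ C₂ : ℝ, 0 < C₁ ∧ 0 < C₂ ∧
      ∀ n : ℤ, |σ n| ≤ C₁ * Real.exp (-C₂ * |(n:ℝ)|))
    (h : ∀ k, HasSum (fun n : ℤ => σ n * Real.cos (2*π*n*k)) (σhat k)) :
    Differentiable ℝ σhat := by
  obtain ⟨C₁, C₂, h1, h2, hb⟩ := hσdecay
  have hs := (aux_summ σ C₁ C₂ h2 1).mul_left (2*π)
  have e : σhat = fun k => ∑' n : ℤ, σ n * Real.cos (2*π*n*k) := funext fun k => (h k).tsum_eq.symm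
  rw [e]
  apply differentiable_tsum' (g' := fun (n : ℤ) k => σ n * (-Real.sin (2*π*n*k) * (2*π*n))) hs
  · intro n k
    apply HasDerivAt.const_mul
    apply HasDerivAt.cos
    simpa using (hasDerivAt_id k).const_mul (2*π*(n:ℝ))
  · intro n k
    have : |Real.sin (2*π*n*k)| ≤ 1 := Real.abs_sin_le_one _
    rw [Real.norm_eq_abs, abs_mul, abs_mul, abs_neg, abs_mul, abs_of_pos (by positivity : 0 < 2*π)]
    calc _ ≤ (C₁ * Real.exp (-C₂ * |(n:ℝ)|)) * (1 * (2*π*|(n:ℝ)|)) := by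
          gcongr; exact hb n
      _ = _ := by ring

lemma aux_quad (f : ℝ → ℝ) (hf : Differentiable ℝ f) (h0 : f 0 = 0)
    (hpos : ∀ k : ℝ, (∀ m : ℤ, k ≠ (m:ℝ)) → 0 < f k) (h2 : 0 < deriv (deriv f) 0) :
    ∃ c : ℝ, 0 < c ∧ ∀ k ∈ Set.Icc (-(1/2) : ℝ) (1/2), c * k^2 ≤ f k := by
  have hp : ∀ k ∈ Set.Icc (-(1/2) : ℝ) (1/2), k ≠ 0 → 0 < f k := by
    intro k hk hk0
    apply hpos
    intro m hm
    have a1 : (m:ℝ) < 1 := by linarith [hk.2]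
    have a2 : (-1:ℝ) < m := by linarith [hk.1]
    have b1 : m < 1 := by exact_mod_cast a1
    have b2 : -1 < m := by exact_mod_cast a2
    have : m = 0 := by omega
    apply hk0; rw [hm, this]; simp
  have hmin : IsLocalMin f 0 := by
    have : Set.Icc (-(1/2) : ℝ) (1/2) ∈ nhds (0:ℝ) := Icc_mem_nhds (by norm_num) (by norm_num)
    filter_upwards [this] with k hk
    by_cases h : k = 0
    · rw [h]
    · rw [h0]; exact (hp k hk h).le
  have hd0 := hmin.deriv_eq_zero
  set a := deriv (deriv f) 0 with ha
  have hdd : DifferentiableAt ℝ (deriv f) 0 := by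
    by_contra hc
    rw [deriv_zero_of_not_differentiableAt hc] at ha
    linarith
  have hg1 : deriv (fun x => f x - a/4 * x^2) = fun x => deriv f x - a/2 * x := by
    funext x
    have e : HasDerivAt (fun x : ℝ => a/4 * x^2) (a/4 * (2 * x)) x := by
      simpa using (hasDerivAt_pow 2 x).const_mul (a/4)
    have e2 : deriv (fun x => f x - a/4 * x^2) x = deriv f x - a/4 * (2 * x) :=
      ((hf x).hasDerivAt.sub e).deriv
    rw [e2]; ring
  have hg2 : deriv (deriv (fun x => f x - a/4 * x^2)) 0 = a - a/2 := by
    rw [hg1]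
    have e : HasDerivAt (fun x : ℝ => a/2 * x) (a/2) 0 := by
      simpa using (hasDerivAt_id (0:ℝ)).const_mul (a/2)
    exact (hdd.hasDerivAt.sub e).deriv
  have hloc := isLocalMin_of_deriv_deriv_pos (f := fun x => f x - a/4 * x^2) (x₀ := 0)
    (by rw [hg2]; linarith) (by rw [hg1]; simp [hd0])
    (by have := hf.continuous; fun_prop)
  obtain ⟨δ, hδ, hball⟩ := Metric.eventually_nhds_iff.1 hloc
  have hcomp : IsCompact (Set.Icc (-(1/2) : ℝ) (1/2) ∩ {k | δ ≤ |k|}) :=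
    isCompact_Icc.inter_right (isClosed_le continuous_const continuous_abs)
  obtain ⟨m, hm, hmb⟩ : ∃ m : ℝ, 0 < m ∧
      ∀ k ∈ Set.Icc (-(1/2) : ℝ) (1/2) ∩ {k | δ ≤ |k|}, m ≤ f k := by
    by_cases hne : (Set.Icc (-(1/2) : ℝ) (1/2) ∩ {k | δ ≤ |k|}).Nonempty
    · obtain ⟨x, hx, hxm⟩ := hcomp.exists_isMinOn hne hf.continuous.continuousOn
      refine ⟨f x, hp x hx.1 ?_, fun k hk => hxm hk⟩
      rintro rfl
      have := hx.2
      simp at this; linarith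
    · exact ⟨1, one_pos, fun k hk => absurd ⟨k, hk⟩ hne⟩
  refine ⟨min (a/4) m, by positivity, fun k hk => ?_⟩
  by_cases hkδ : δ ≤ |k|
  · have := hmb k ⟨hk, hkδ⟩
    have h3 : k^2 ≤ 1 := by nlinarith [hk.1, hk.2]
    have h4 : min (a/4) m ≤ m := min_le_right _ _
    nlinarith [sq_nonneg k]
  · have := hball (y := k) (by simpa [Real.dist_eq] using hkδ)
    simp [h0] at this
    have h4 : min (a/4) m ≤ a/4 := min_le_left _ _
    nlinarith [sq_nonneg k]

/-- **Lemma (boundedness of `K̂_M/ω`):** under the assumptions on the coupling `σ` and on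
the control `M`, there is a constant `C > 0` with `|K̂_M(k,k')| ≤ C·ω(k)` for all
`k, k' ∈ [−1/2,1/2]`; in particular `sup |K̂_M(k,k')/ω(k)| < ∞`. -/
theorem Khat_le_omega (N : ℕ) (hN : 1 ≤ N) (M : ℤ → ℝ)
    (hM1 : ∀ d : ℤ, M d + M (-d) = 0)
    (hM2 : ∀ d : ℤ, (2*|d| ≤ (N:ℤ) ∨ (N:ℤ) < |d|) → M d = 0)
    (σ : ℤ → ℝ) (σhat : ℝ → ℝ)
    (hσeven : ∀ n : ℤ, σ (-n) = σ n)
    (hσne : ∃ n : ℤ, n ≠ 0 ∧ σ n ≠ 0)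
    (hσdecay : ∃ C₁ C₂ : ℝ, 0 < C₁ ∧ 0 < C₂ ∧
      ∀ n : ℤ, |σ n| ≤ C₁ * Real.exp (-C₂ * |(n:ℝ)|))
    (hσhat : ∀ k : ℝ, HasSum
      (fun n : ℤ => (σ n : ℂ) * Complex.exp (-(2*(π:ℂ)*Complex.I) * k * n))
      ((σhat k : ℂ)))
    (hpin : (∀ k : ℝ, 0 < σhat k) ∨
      (σhat 0 = 0 ∧ (∀ k : ℝ, (∀ m : ℤ, k ≠ (m:ℝ)) → 0 < σhat k) ∧
        0 < deriv (deriv σhat) 0)) :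
    ∃ C : ℝ, 0 < C ∧ ∀ k ∈ Set.Icc (-(1/2) : ℝ) (1/2), ∀ k' ∈ Set.Icc (-(1/2) : ℝ) (1/2),
      |Khat N M k k'| ≤ C * Real.sqrt (σhat k) := by
  obtain ⟨A, hA, hb⟩ := aux_Khat_bound N M hM1 hM2
  have hr := aux_real σ σhat hσhat
  have hdiff := aux_diff σ σhat hσdecay hr
  obtain ⟨c, hc, hq⟩ : ∃ c : ℝ, 0 < c ∧
      ∀ k ∈ Set.Icc (-(1/2) : ℝ) (1/2), c * k^2 ≤ σhat k := by
    rcases hpin with h | ⟨h0, hp, h2⟩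
    · obtain ⟨x, hx, hxm⟩ := (isCompact_Icc (a := (-(1/2) : ℝ)) (b := 1/2)).exists_isMinOn
        ⟨0, by norm_num⟩ hdiff.continuous.continuousOn
      refine ⟨σhat x, h x, fun k hk => ?_⟩
      have h1 : σhat x ≤ σhat k := hxm hk
      have h3 : k^2 ≤ 1 := by nlinarith [hk.1, hk.2]
      nlinarith [h x]
    · exact aux_quad σhat hdiff h0 hp h2
  have hsc : 0 < Real.sqrt c := Real.sqrt_pos.2 hc
  refine ⟨A / Real.sqrt c, by positivity, fun k hk k' _ => ?_⟩
  have h1 : Real.sqrt c * |k| ≤ Real.sqrt (σhat k) := by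
    rw [← Real.sqrt_sq_eq_abs, ← Real.sqrt_mul hc.le]
    exact Real.sqrt_le_sqrt (hq k hk)
  calc |Khat N M k k'| ≤ A * |k| := hb k k'
    _ = A / Real.sqrt c * (Real.sqrt c * |k|) := by field_simp
    _ ≤ _ := by gcongr
end

section
/- There exists a constant C > 0 (depending only on N and M) such that |K̂_M(k,k')| ≤ C·|k| for all k ∈ [−1/2, 1/2] and all k' ∈ ℝ. -/
open Finset Real

set_option linter.unusedSimpArgs false

/-- Uniform formula for the off-diagonal part. -/
noncomputable def Foff (M : ℤ → ℝ) (d d' : ℤ) : ℝ :=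
  (1/2) * (M d' * M (d - d') + M d * M (d' - d) - M d' * M (d + d') - M d * M (d + d'))

lemma sum_shift (N : ℕ) (M : ℤ → ℝ) (hodd : ∀ d, M (-d) = -M d)
    (hout : ∀ d : ℤ, (N:ℤ) < |d| → M d = 0) (e : ℤ) (he : |e| ≤ N) :
    ∑ d ∈ Finset.Icc (-(2*(N:ℤ))) (2*(N:ℤ)), M (d + e) = 0 := by
  rw [abs_le] at he
  have h1 : ∑ d ∈ Finset.Icc (-(2*(N:ℤ))) (2*(N:ℤ)), M (d + e)
      = ∑ d ∈ Finset.Icc (-(N:ℤ)) N, M d := by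
    have : ∑ d ∈ Finset.Icc (-(2*(N:ℤ))) (2*(N:ℤ)), M (d + e)
      = ∑ d ∈ Finset.Icc (-(2*(N:ℤ)) + e) (2*(N:ℤ) + e), M d := by
      apply Finset.sum_bij' (fun d _ => d + e) (fun d _ => d - e) <;> intros <;>
        simp_all <;> omega
    rw [this]
    symm
    apply Finset.sum_subset
    · intro x hx
      rw [Finset.mem_Icc] at *
      omega
    · intro x _ hx
      apply hout
      rw [Finset.mem_Icc] at hx
      by_contra h
      rw [not_lt, abs_le] at h
      exact hx h
  rw [h1]
  have h2 : ∑ d ∈ Finset.Icc (-(N:ℤ)) N, M d = ∑ d ∈ Finset.Icc (-(N:ℤ)) N, -M d := by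
    apply Finset.sum_bij' (fun d _ => -d) (fun d _ => -d) <;> intros <;>
      simp_all [Finset.mem_Icc] <;> omega
  rw [Finset.sum_neg_distrib] at h2
  linarith

lemma sum_extend (N : ℕ) (f : ℤ → ℝ) (hout : ∀ d : ℤ, (N:ℤ) < |d| → f d = 0) :
    ∑ d ∈ Finset.Icc (-(N:ℤ)) N, f d = ∑ d ∈ Finset.Icc (-(2*(N:ℤ))) (2*(N:ℤ)), f d := by
  apply Finset.sum_subset
  · intro x hx
    rw [Finset.mem_Icc] at *
    omega
  · intro x _ hx
    apply hout
    rw [Finset.mem_Icc] at hx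
    by_contra h
    rw [not_lt, abs_le] at h
    exact hx h

lemma Sig_eq (N : ℕ) (M : ℤ → ℝ) (h0 : M 0 = 0)
    (hout : ∀ d : ℤ, (N:ℤ) < |d| → M d = 0) (e : ℤ) :
    Sig N M e = ∑ d ∈ Finset.Icc (-(2*(N:ℤ))) (2*(N:ℤ)), M d * M (e - d) := by
  rw [← sum_extend N (fun d => M d * M (e - d)) (fun d hd => by simp [hout d hd])]
  unfold Sig
  apply Finset.sum_congr rfl
  intro d _
  rw [Finset.sum_eq_single (e - d)]
  · split_ifs with h
    · rfl
    · by_cases hd : d = 0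
      · simp [hd, h0]
      · have : e - d = 0 := by
          by_contra h3
          exact h ⟨by ring, hd, h3⟩
        simp [this, h0]
  · intro b _ hb
    rw [if_neg]
    rintro ⟨h, -⟩
    omega
  · intro h
    have : M (e - d) = 0 := by
      apply hout
      rw [Finset.mem_Icc] at h
      by_contra h'
      rw [not_lt, abs_le] at h'
      exact h h'
    simp [this]

lemma sum_reflect (n : ℤ) (f : ℤ → ℝ) :
    ∑ d ∈ Finset.Icc (-n) n, f (-d) = ∑ d ∈ Finset.Icc (-n) n, f d := by
  apply Finset.sum_bij' (fun d _ => -d) (fun d _ => -d) <;> intros <;>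
    simp_all [Finset.mem_Icc] <;> omega

lemma Sig_neg (N : ℕ) (M : ℤ → ℝ) (h0 : M 0 = 0) (hodd : ∀ d, M (-d) = -M d)
    (hout : ∀ d : ℤ, (N:ℤ) < |d| → M d = 0) (e : ℤ) : Sig N M (-e) = Sig N M e := by
  rw [Sig_eq N M h0 hout, Sig_eq N M h0 hout, ← sum_reflect]
  apply Finset.sum_congr rfl
  intro d _
  rw [show -e - -d = -(e - d) by ring, hodd, hodd]
  ring

lemma sum_Foff (N : ℕ) (M : ℤ → ℝ) (h0 : M 0 = 0) (hodd : ∀ d, M (-d) = -M d)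
    (hout : ∀ d : ℤ, (N:ℤ) < |d| → M d = 0) (e : ℤ) :
    ∑ d ∈ Finset.Icc (-(2*(N:ℤ))) (2*(N:ℤ)), Foff M d e = Sig N M e := by
  have hz : ∀ s : ℤ, |s| = |e| → M e * ∑ d ∈ Finset.Icc (-(2*(N:ℤ))) (2*(N:ℤ)), M (d + s) = 0 := by
    intro s hs
    by_cases he : |e| ≤ N
    · rw [sum_shift N M hodd hout s (by rw [hs]; exact he), mul_zero]
    · rw [hout e (by omega), zero_mul]
  have h1 := hz e rfl
  have h2 := hz (-e) (abs_neg e)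
  have h3 : ∑ d ∈ Finset.Icc (-(2*(N:ℤ))) (2*(N:ℤ)), M d * M (d + e) = - Sig N M e := by
    rw [Sig_eq N M h0 hout, ← sum_reflect, ← Finset.sum_neg_distrib]
    apply Finset.sum_congr rfl
    intro d _
    rw [hodd, show -d + e = e - d by ring]
    ring
  have h4 := Sig_eq N M h0 hout e
  unfold Foff
  rw [← Finset.mul_sum, Finset.sum_sub_distrib, Finset.sum_sub_distrib, Finset.sum_add_distrib,
    ← Finset.mul_sum, ← Finset.mul_sum, h1, h3, ← h4]
  simp only [sub_eq_add_neg] at h2 ⊢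
  rw [h2]
  ring

lemma sum_Sig (N : ℕ) (M : ℤ → ℝ) (h0 : M 0 = 0) (hodd : ∀ d, M (-d) = -M d)
    (hout : ∀ d : ℤ, (N:ℤ) < |d| → M d = 0) :
    ∑ e ∈ Finset.Icc (-(2*(N:ℤ))) (2*(N:ℤ)), Sig N M e = 0 := by
  simp_rw [Sig_eq N M h0 hout]
  rw [Finset.sum_comm]
  apply Finset.sum_eq_zero
  intro d _
  rw [← Finset.mul_sum]
  by_cases hd : |d| ≤ N
  · simp_rw [sub_eq_add_neg]
    rw [sum_shift N M hodd hout (-d) (by rw [abs_neg]; exact hd), mul_zero]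
  · rw [hout d (by omega), zero_mul]

lemma Sig_zero (N : ℕ) (M : ℤ → ℝ) (h0 : M 0 = 0) (hodd : ∀ d, M (-d) = -M d)
    (hout : ∀ d : ℤ, (N:ℤ) < |d| → M d = 0) :
    Sig N M 0 = -(2 * ∑ j ∈ Finset.Icc (1:ℤ) N, M j ^ 2) := by
  rw [Sig_eq N M h0 hout, ← sum_extend N (fun d => M d * M (0 - d)) (fun d hd => by simp [hout d hd])]
  have hS : Finset.Icc (-(N:ℤ)) N = Finset.Icc (-(N:ℤ)) (-1) ∪ ({0} ∪ Finset.Icc 1 (N:ℤ)) := by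
    ext x
    simp only [Finset.mem_Icc, Finset.mem_union, Finset.mem_singleton]
    omega
  rw [hS, Finset.sum_union, Finset.sum_union]
  · have : ∑ d ∈ Finset.Icc (-(N:ℤ)) (-1), M d * M (0 - d)
        = ∑ d ∈ Finset.Icc (1:ℤ) N, M d * M (0 - d) := by
      apply Finset.sum_bij' (fun d _ => -d) (fun d _ => -d) <;> intros <;>
        simp_all [Finset.mem_Icc, mul_comm] <;> omega
    rw [this, Finset.sum_singleton, h0]
    have : ∑ d ∈ Finset.Icc (1:ℤ) N, M d * M (0 - d) = - ∑ j ∈ Finset.Icc (1:ℤ) N, M j ^ 2 := by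
      rw [← Finset.sum_neg_distrib]
      apply Finset.sum_congr rfl
      intro d _
      rw [zero_sub, hodd]
      ring
    rw [this]
    ring
  · rw [Finset.disjoint_left]
    intro x
    simp only [Finset.mem_Icc, Finset.mem_singleton]
    omega
  · rw [Finset.disjoint_left]
    intro x
    simp only [Finset.mem_Icc, Finset.mem_union, Finset.mem_singleton]
    omega

lemma Kcoef_zero_right (N : ℕ) (M : ℤ → ℝ) (h0 : M 0 = 0) (hodd : ∀ d, M (-d) = -M d)
    (hout : ∀ d : ℤ, (N:ℤ) < |d| → M d = 0) (d : ℤ) (hd : |d| ≤ 2 * N) :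
    Kcoef N M d 0 = Foff M d 0 - (1/2) * Sig N M d +
      (if d = 0 then 3 * ∑ j ∈ Finset.Icc (1:ℤ) N, M j ^ 2 + (1/2) * Sig N M 0 else 0) := by
  by_cases h : d = 0
  · subst h
    simp [Kcoef, Foff, h0]
  · have hp : 1 ≤ |d| := Int.one_le_abs h
    by_cases h2 : |d| ≤ N
    · simp only [Kcoef, Foff, h, hp, h2, h0, zero_sub, hodd, sub_zero, add_zero, if_false, if_true,
        and_true, true_and, false_and, and_self]
      ring
    · have h3 : (N:ℤ) + 1 ≤ |d| := by omega
      simp only [Kcoef, Foff, h, hp, h2, h3, hd, h0, hout d (by omega), if_false, if_true,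
        and_true, true_and, false_and, and_false, and_self]
      simp

lemma Kcoef_ne_zero (N : ℕ) (M : ℤ → ℝ) (hodd : ∀ d, M (-d) = -M d)
    (hM2 : ∀ d : ℤ, (2*|d| ≤ (N:ℤ) ∨ (N:ℤ) < |d|) → M d = 0)
    (hs : ∀ e, Sig N M (-e) = Sig N M e)
    (d e : ℤ) (he0 : e ≠ 0) (hd : |d| ≤ 2 * N) (he : |e| ≤ 2 * N) :
    Kcoef N M d e = Foff M d e + (if d = 0 then -(1/2) * Sig N M e else 0)
      + (if d = e then -(1/4) * Sig N M e else 0)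
      + (if d = -e then -(1/4) * Sig N M e else 0) := by
  have hpe : 1 ≤ |e| := Int.one_le_abs he0
  have h0 : M 0 = 0 := hM2 0 (by simp)
  have hprod : ∀ x, M x * M (2 * x) = 0 := by
    intro x
    by_cases hx : 2 * |x| ≤ N
    · rw [hM2 x (Or.inl hx), zero_mul]
    · rw [hM2 (2*x) (Or.inr (by rw [abs_mul]; simp; omega)), mul_zero]
  have hout : ∀ d : ℤ, (N:ℤ) < |d| → M d = 0 := fun d h => hM2 d (Or.inr h)
  by_cases h : d = 0
  · subst h
    have hne : ¬ (0 = e) := fun h => he0 h.symm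
    have hne' : ¬ (0 = -e) := by omega
    by_cases h2 : |e| ≤ N
    · simp [Kcoef, Foff, he0, hne, hpe, h2, h0, hodd]
      ring
    · have h3 : (N:ℤ) + 1 ≤ |e| := by omega
      simp [Kcoef, Foff, he0, hne, hpe, h2, h3, he, h0, hout e (by omega)]
  have hpd : 1 ≤ |d| := Int.one_le_abs h
  by_cases hde : d = e
  · subst hde
    have hne : ¬ (d = -d) := by omega
    have := hprod d
    have h2 : M (d + d) = M (2 * d) := by rw [two_mul]
    simp [Kcoef, Foff, h, hne, hpd, hd, h0, h2, this]
  by_cases hde' : d = -e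
  · subst hde'
    have := hprod e
    have h2 : M (-e - e) = -M (2 * e) := by rw [← hodd]; congr 1; ring
    have h3 : M (e - -e) = M (2 * e) := by congr 1; ring
    have h4 : M (2 * -e) = -M (2 * e) := by rw [← hodd]; congr 1; ring
    have h5 : M (e + e) = M (2 * e) := by rw [two_mul]
    rw [abs_neg] at *
    simp [Kcoef, Foff, h, he0, hpe, he, h0, h2, h3, h4, h5, hodd, hde, hs, this]
  have hde2 : ¬ (e = d) := fun h => hde h.symm
  have hde3 : ¬ (e = -d) := by omega
  have hA : ∀ x, ¬ |x| ≤ (N:ℤ) → M x = 0 := fun x hx => hout x (by omega)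
  have c1 : |d - e| = |e - d| := abs_sub_comm _ _
  have c2 : |d + e| = |e + d| := by rw [add_comm]
  have c3 : M (d - e) = -M (e - d) := by rw [← hodd]; congr 1; ring
  have c4 : M (d + e) = M (e + d) := by rw [add_comm]
  have key : |e - d| ≤ N → |e + d| ≤ N → |d| ≤ N ∧ |e| ≤ N := by
    simp only [abs_le]; omega
  by_cases a1 : |d| ≤ N <;> by_cases a2 : |e| ≤ N <;>
  by_cases a3 : |e - d| ≤ N <;> by_cases a4 : |e + d| ≤ N <;>
  first
  | (exfalso; have := key a3 a4; tauto)
  | (have b1 := hA d; have b2 := hA e; have b3 := hA (e - d); have b4 := hA (e + d)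
     simp only [a1, a2, a3, a4, not_true, not_false_eq_true, false_imp_iff, true_imp_iff] at b1 b2 b3 b4
     have n1 : (N:ℤ) < |d| ↔ ¬ |d| ≤ N := not_le.symm
     have n2 : (N:ℤ) < |e| ↔ ¬ |e| ≤ N := not_le.symm
     have n3 : (N:ℤ) < |e - d| ↔ ¬ |e - d| ≤ N := not_le.symm
     have n4 : (N:ℤ) < |e + d| ↔ ¬ |e + d| ≤ N := not_le.symm
     simp only [Kcoef, Foff, h, he0, hde, hde', hde2, hde3, hpd, hpe, hd, he, c1, c2, c3, c4,
       n1, n2, n3, n4, a1, a2, a3, a4, and_true, true_and, and_false, false_and, if_true, if_false,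
       not_true, not_false_eq_true, or_self, and_self]
     try simp only [b1, b2, b3, b4]
     try ring)

lemma sum_Kcoef (N : ℕ) (M : ℤ → ℝ) (hodd : ∀ d, M (-d) = -M d)
    (hM2 : ∀ d : ℤ, (2*|d| ≤ (N:ℤ) ∨ (N:ℤ) < |d|) → M d = 0) (e : ℤ)
    (he : e ∈ Finset.Icc (-(2*(N:ℤ))) (2*(N:ℤ))) :
    ∑ d ∈ Finset.Icc (-(2*(N:ℤ))) (2*(N:ℤ)), Kcoef N M d e = 0 := by
  have h0 : M 0 = 0 := hM2 0 (by simp)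
  have hout : ∀ d : ℤ, (N:ℤ) < |d| → M d = 0 := fun d h => hM2 d (Or.inr h)
  have hz : (0:ℤ) ∈ Finset.Icc (-(2*(N:ℤ))) (2*(N:ℤ)) := by
    rw [Finset.mem_Icc]; omega
  have hn : -e ∈ Finset.Icc (-(2*(N:ℤ))) (2*(N:ℤ)) := by
    rw [Finset.mem_Icc] at *; omega
  by_cases h : e = 0
  · subst h
    rw [Finset.sum_congr rfl (fun d hd => Kcoef_zero_right N M h0 hodd hout d
      (abs_le.mpr (Finset.mem_Icc.mp hd)))]
    rw [Finset.sum_add_distrib, Finset.sum_sub_distrib, ← Finset.mul_sum, sum_Sig N M h0 hodd hout,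
      sum_Foff N M h0 hodd hout, Finset.sum_ite_eq' , if_pos hz, Sig_zero N M h0 hodd hout]
    ring
  · rw [Finset.sum_congr rfl (fun d hd => Kcoef_ne_zero N M hodd hM2 (Sig_neg N M h0 hodd hout) d e h
      (abs_le.mpr (Finset.mem_Icc.mp hd)) (abs_le.mpr (Finset.mem_Icc.mp he)))]
    rw [Finset.sum_add_distrib, Finset.sum_add_distrib, Finset.sum_add_distrib,
      sum_Foff N M h0 hodd hout, Finset.sum_ite_eq', Finset.sum_ite_eq', Finset.sum_ite_eq',
      if_pos hz, if_pos he, if_pos hn]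
    ring

lemma abs_cos_sub_one_le (x : ℝ) : |Real.cos x - 1| ≤ |x| := by
  have h1 := Real.one_sub_sq_div_two_le_cos (x := x)
  have h2 := Real.cos_le_one x
  have h3 := Real.neg_one_le_cos x
  rw [abs_le]
  have h4 := abs_nonneg x
  have h5 := sq_abs x
  refine ⟨?_, by linarith⟩
  by_cases h : |x| ≤ 2
  · nlinarith
  · linarith

/-- **Linear bound on the kernel:** there exists `C > 0` (depending only on `N` and `M`)
such that `|K̂_M(k,k')| ≤ C·|k|` for all `k ∈ [−1/2,1/2]` and all `k' ∈ ℝ`. -/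
theorem Khat_le_abs (N : ℕ) (hN : 1 ≤ N) (M : ℤ → ℝ)
    (hM1 : ∀ d : ℤ, M d + M (-d) = 0)
    (hM2 : ∀ d : ℤ, (2*|d| ≤ (N:ℤ) ∨ (N:ℤ) < |d|) → M d = 0) :
    ∃ C : ℝ, 0 < C ∧ ∀ k ∈ Set.Icc (-(1/2) : ℝ) (1/2), ∀ k' : ℝ,
      |Khat N M k k'| ≤ C * |k| := by
  have hodd : ∀ d, M (-d) = -M d := fun d => by linarith [hM1 d]
  set I := Finset.Icc (-(2*(N:ℤ))) (2*(N:ℤ)) with hI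
  have hnn : 0 ≤ ∑ d ∈ I, ∑ d' ∈ I, |Kcoef N M d d'| * |2 * π * d| := by positivity
  refine ⟨(∑ d ∈ I, ∑ d' ∈ I, |Kcoef N M d d'| * |2 * π * d|) + 1, by linarith, ?_⟩
  intro k _ k'
  have hzero : ∑ d ∈ I, ∑ d' ∈ I, Kcoef N M d d' * Real.cos (2*π*d'*k') = 0 := by
    rw [Finset.sum_comm]
    apply Finset.sum_eq_zero
    intro e he
    rw [← Finset.sum_mul, sum_Kcoef N M hodd hM2 e he, zero_mul]
  have heq : Khat N M k k' = ∑ d ∈ I, ∑ d' ∈ I,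
      Kcoef N M d d' * (Real.cos (2*π*d*k) - 1) * Real.cos (2*π*d'*k') := by
    rw [← sub_zero (Khat N M k k'), ← hzero, Khat, ← Finset.sum_sub_distrib]
    apply Finset.sum_congr rfl
    intro d _
    rw [← Finset.sum_sub_distrib]
    apply Finset.sum_congr rfl
    intro d' _
    ring
  have hb : |Khat N M k k'| ≤ (∑ d ∈ I, ∑ d' ∈ I, |Kcoef N M d d'| * |2 * π * d|) * |k| := by
    rw [heq, Finset.sum_mul]
    refine (Finset.abs_sum_le_sum_abs _ _).trans (Finset.sum_le_sum fun d _ => ?_)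
    rw [Finset.sum_mul]
    refine (Finset.abs_sum_le_sum_abs _ _).trans (Finset.sum_le_sum fun d' _ => ?_)
    rw [abs_mul, abs_mul]
    have h1 := abs_cos_sub_one_le (2*π*d*k)
    rw [abs_mul (2*π*d) k] at h1
    have h2 := Real.abs_cos_le_one (2*π*d'*k')
    calc _ ≤ |Kcoef N M d d'| * (|2*π*d| * |k|) * 1 := by gcongr
      _ = _ := by ring
  nlinarith [abs_nonneg k]
end

section
/- In the no-pinning case, the dispersion relation is comparable to |k|: there exist constants 0 < c ≤ C such that c·|k| ≤ ω(k) ≤ C·|k| for all k ∈ [−1/2, 1/2]. -/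
open Real

/-- **No-pinning dispersion relation is comparable to `|k|`:** there exist constants
`0 < c ≤ C` such that `c·|k| ≤ ω(k) ≤ C·|k|` for all `k ∈ [−1/2,1/2]`, where
`ω(k) = √(σ̂(k))`. -/
theorem omega_comparable_abs
    (σ : ℤ → ℝ) (σhat : ℝ → ℝ)
    (hσeven : ∀ n : ℤ, σ (-n) = σ n)
    (hσne : ∃ n : ℤ, n ≠ 0 ∧ σ n ≠ 0)
    (hσdecay : ∃ C₁ C₂ : ℝ, 0 < C₁ ∧ 0 < C₂ ∧
      ∀ n : ℤ, |σ n| ≤ C₁ * Real.exp (-C₂ * |(n:ℝ)|))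
    (hσhat : ∀ k : ℝ, HasSum
      (fun n : ℤ => (σ n : ℂ) * Complex.exp (-(2*(π:ℂ)*Complex.I) * k * n))
      ((σhat k : ℂ)))
    (h0 : σhat 0 = 0)
    (hpos : ∀ k : ℝ, (∀ m : ℤ, k ≠ (m:ℝ)) → 0 < σhat k)
    (h2 : 0 < deriv (deriv σhat) 0) :
    ∃ c C : ℝ, 0 < c ∧ c ≤ C ∧ ∀ k ∈ Set.Icc (-(1/2) : ℝ) (1/2),
      c * |k| ≤ Real.sqrt (σhat k) ∧ Real.sqrt (σhat k) ≤ C * |k| := by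
  obtain ⟨C₁, C₂, hC₁, hC₂, hdec⟩ := hσdecay
  have hexp : ∀ p : ℕ, Summable (fun n : ℤ => |(n:ℝ)|^p * Real.exp (-C₂ * |(n:ℝ)|)) := by
    intro p
    have := Real.summable_pow_mul_exp_neg_nat_mul p hC₂
    apply Summable.of_nat_of_neg
    · simpa using this
    · simpa using this
  have hs : ∀ p : ℕ, Summable (fun n : ℤ => |(n:ℝ)|^p * |σ n|) := by
    intro p
    refine Summable.of_nonneg_of_le (fun n => by positivity) (fun n => ?_) ((hexp p).mul_left C₁)
    calc |(n:ℝ)|^p * |σ n| ≤ |(n:ℝ)|^p * (C₁ * Real.exp (-C₂ * |(n:ℝ)|)) := by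
          gcongr; exact hdec n
      _ = _ := by ring
  have hreal : ∀ k : ℝ, HasSum (fun n : ℤ => σ n * Real.cos (2*π*n*k)) (σhat k) := by
    intro k
    have h := Complex.hasSum_re (hσhat k)
    rw [Complex.ofReal_re] at h
    convert h using 2 with n
    rw [Complex.re_ofReal_mul]
    congr 1
    have : -(2*(π:ℂ)*Complex.I) * k * n = ((-(2*π*n*k) : ℝ) : ℂ) * Complex.I := by
      push_cast; ring
    rw [this, Complex.exp_ofReal_mul_I_re, Real.cos_neg]
  have hdiff : Differentiable ℝ σhat := by
    have he : σhat = fun k => ∑' n : ℤ, σ n * Real.cos (2*π*n*k) :=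
      funext fun k => (hreal k).tsum_eq.symm
    rw [he]
    refine differentiable_tsum' (u := fun n : ℤ => (2*π) * (|(n:ℝ)|^1 * |σ n|))
      (g' := fun n k => σ n * (-Real.sin (2*π*n*k) * (2*π*n))) ((hs 1).mul_left _) ?_ ?_
    · intro n y
      have h1 : HasDerivAt (fun k : ℝ => 2*π*n*k) (2*π*n) y := by
        simpa using (hasDerivAt_id y).const_mul (2*π*(n:ℝ))
      exact h1.cos.const_mul (σ n)
    · intro n y
      rw [Real.norm_eq_abs, abs_mul, abs_mul, abs_neg, abs_mul (2*π) (n:ℝ),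
        abs_of_pos (by positivity : (0:ℝ) < 2*π)]
      have := Real.abs_sin_le_one (2*π*n*y)
      calc |σ n| * (|Real.sin (2*π*n*y)| * (2*π*|(n:ℝ)|)) ≤ |σ n| * (1 * (2*π*|(n:ℝ)|)) := by
            gcongr
        _ = _ := by ring
  have hpos' : ∀ k : ℝ, |k| < 1 → k ≠ 0 → 0 < σhat k := by
    intro k hk hk0
    apply hpos
    rintro m rfl
    have h1 : |m| < 1 := by exact_mod_cast hk
    have h2 : m = 0 := Int.abs_lt_one_iff.mp h1
    exact hk0 (by simp [h2])
  -- upper bound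
  set K : ℝ := ∑' n : ℤ, 2*π^2 * (|(n:ℝ)|^2 * |σ n|) with hK
  have hKs : HasSum (fun n : ℤ => 2*π^2 * (|(n:ℝ)|^2 * |σ n|)) K :=
    ((hs 2).mul_left _).hasSum
  have hK0 : 0 ≤ K := tsum_nonneg fun n => by positivity
  have hup : ∀ k : ℝ, σhat k ≤ K * k^2 := by
    intro k
    have h := (hreal k).sub (hreal 0)
    rw [h0, sub_zero] at h
    refine hasSum_le (fun n => ?_) h (hKs.mul_right (k^2))
    have h1 : 1 - (2*π*n*k)^2/2 ≤ Real.cos (2*π*n*k) := Real.one_sub_sq_div_two_le_cos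
    have h2 := Real.cos_le_one (2*π*n*k)
    have h3 : |1 - Real.cos (2*π*n*k)| ≤ (2*π*n*k)^2/2 := by
      rw [abs_of_nonneg (by linarith)]; linarith
    calc σ n * Real.cos (2*π*n*k) - σ n * Real.cos (2*π*n*0)
        = -(σ n) * (1 - Real.cos (2*π*n*k)) := by simp; ring
      _ ≤ |-(σ n) * (1 - Real.cos (2*π*n*k))| := le_abs_self _
      _ = |σ n| * |1 - Real.cos (2*π*n*k)| := by rw [abs_mul, abs_neg]
      _ ≤ |σ n| * ((2*π*n*k)^2/2) := by gcongr
      _ = 2*π^2 * (|(n:ℝ)|^2 * |σ n|) * k^2 := by rw [sq_abs]; ring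
  -- lower bound near zero
  have hd0 : deriv σhat 0 = 0 := by
    apply IsLocalMin.deriv_eq_zero
    filter_upwards [Metric.ball_mem_nhds (0:ℝ) one_pos] with k hk
    rw [h0]
    by_cases hk0 : k = 0
    · rw [hk0, h0]
    · exact (hpos' k (by simpa using hk) hk0).le
  set a : ℝ := deriv (deriv σhat) 0 / 4 with ha
  have ha0 : 0 < a := by positivity
  have hg1 : deriv (fun k => σhat k - a * k^2) = fun k => deriv σhat k - a * (2 * k) := by
    funext k
    have h1 : HasDerivAt (fun k : ℝ => a * k^2) (a * (2 * k)) k := by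
      simpa using (hasDerivAt_pow 2 k).const_mul a
    exact ((hdiff k).hasDerivAt.sub h1).deriv
  have hg2 : deriv (deriv (fun k => σhat k - a * k^2)) 0 = deriv (deriv σhat) 0 - a * 2 := by
    rw [hg1]
    have h1 : HasDerivAt (fun k : ℝ => a * (2 * k)) (a * 2) 0 := by
      simpa using ((hasDerivAt_id (0:ℝ)).const_mul 2).const_mul a
    exact ((differentiableAt_of_deriv_ne_zero h2.ne').hasDerivAt.sub h1).deriv
  have hmin : IsLocalMin (fun k => σhat k - a * k^2) 0 := by
    apply isLocalMin_of_deriv_deriv_pos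
    · rw [hg2]; linarith
    · rw [hg1]; simp [hd0]
    · exact (hdiff.continuous.sub (by fun_prop)).continuousAt
  obtain ⟨δ, hδ, hnear⟩ := Metric.eventually_nhds_iff.mp hmin
  -- lower bound away from zero
  have hcomp : IsCompact (Set.Icc (-(1/2) : ℝ) (1/2) ∩ {k | δ ≤ |k|}) :=
    isCompact_Icc.inter_right (isClosed_le continuous_const continuous_abs)
  have hfar : ∃ m : ℝ, 0 < m ∧ ∀ k ∈ Set.Icc (-(1/2) : ℝ) (1/2) ∩ {k | δ ≤ |k|}, m ≤ σhat k := by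
    rcases Set.eq_empty_or_nonempty (Set.Icc (-(1/2) : ℝ) (1/2) ∩ {k | δ ≤ |k|}) with he | hne
    · exact ⟨1, one_pos, by rw [he]; simp⟩
    · obtain ⟨x, hx, hxm⟩ := hcomp.exists_isMinOn hne hdiff.continuous.continuousOn
      refine ⟨σhat x, hpos' x ?_ ?_, fun k hk => hxm hk⟩
      · rw [abs_lt]; constructor <;> linarith [hx.1.1, hx.1.2]
      · rintro rfl
        have : δ ≤ |(0:ℝ)| := hx.2
        rw [abs_zero] at this
        linarith
  obtain ⟨m, hm, hfar⟩ := hfar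
  have hb : 0 < min a m := lt_min ha0 hm
  have hlow : ∀ k ∈ Set.Icc (-(1/2) : ℝ) (1/2), min a m * k^2 ≤ σhat k := by
    intro k hk
    by_cases hkδ : δ ≤ |k|
    · have h1 := hfar k ⟨hk, hkδ⟩
      have h3 : k^2 ≤ 1 := by nlinarith [hk.1, hk.2]
      have h4 : min a m ≤ m := min_le_right _ _
      nlinarith
    · have h1 := hnear (y := k) (by simpa using hkδ)
      simp only [h0] at h1
      have h4 : min a m * k^2 ≤ a * k^2 := by gcongr; exact min_le_left _ _
      linarith
  refine ⟨√(min a m), √K + √(min a m), Real.sqrt_pos.mpr hb, by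
    linarith [Real.sqrt_nonneg K], fun k hk => ⟨?_, ?_⟩⟩
  · rw [← Real.sqrt_sq_eq_abs, ← Real.sqrt_mul hb.le]
    exact Real.sqrt_le_sqrt (hlow k hk)
  · have h1 : √(σhat k) ≤ √K * |k| := by
      rw [← Real.sqrt_sq_eq_abs, ← Real.sqrt_mul hK0]
      exact Real.sqrt_le_sqrt (hup k)
    have h3 : 0 ≤ √(min a m) * |k| := by positivity
    linarith
end

section
/- In the no-pinning case, the second derivative of the dispersion relation blows up at most like 1/|k| at the origin: there exist δ ∈ (0, 1/2) and C > 0 such that ω is twice differentiable at every k with 0 < |k| ≤ δ and |ω''(k)| ≤ C/|k| for all such k. -/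
open Real

lemma aux_summable (k : ℕ) {r : ℝ} (hr : 0 < r) :
    Summable fun n : ℤ => |(n:ℝ)| ^ k * Real.exp (-r * |(n:ℝ)|) := by
  apply Summable.of_nat_of_neg
  · simpa using Real.summable_pow_mul_exp_neg_nat_mul k hr
  · simpa using Real.summable_pow_mul_exp_neg_nat_mul k hr

lemma aux_contDiff (σ : ℤ → ℝ) (σhat : ℝ → ℝ)
    (hσdecay : ∃ C₁ C₂ : ℝ, 0 < C₁ ∧ 0 < C₂ ∧
      ∀ n : ℤ, |σ n| ≤ C₁ * Real.exp (-C₂ * |(n:ℝ)|))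
    (hσhat : ∀ k : ℝ, HasSum
      (fun n : ℤ => (σ n : ℂ) * Complex.exp (-(2*(π:ℂ)*Complex.I) * k * n))
      ((σhat k : ℂ))) : ContDiff ℝ 2 σhat := by
  obtain ⟨C₁, C₂, hC₁, hC₂, hb⟩ := hσdecay
  have hre : ∀ k : ℝ, HasSum (fun n : ℤ => σ n * Real.cos ((2*π*n) * k)) (σhat k) := by
    intro k
    have h := Complex.hasSum_re (hσhat k)
    rw [Complex.ofReal_re] at h
    convert! h using 2 with n
    rw [Complex.re_ofReal_mul]
    congr 1
    have : -(2*(π:ℂ)*Complex.I) * k * n = ((-((2*π*n) * k) : ℝ) : ℂ) * Complex.I := by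
      push_cast; ring
    rw [this, Complex.exp_ofReal_mul_I_re, Real.cos_neg]
  have hfun : σhat = fun k => ∑' n : ℤ, σ n * Real.cos ((2*π*n) * k) := by
    funext k; exact (hre k).tsum_eq.symm
  rw [hfun]
  have := contDiff_tsum (𝕜 := ℝ) (N := (2 : ℕ∞))
    (f := fun (n : ℤ) (k : ℝ) => σ n * Real.cos ((2*π*n) * k))
    (v := fun k n => (C₁ * (2*π)^k) * (|(n:ℝ)| ^ k * Real.exp (-C₂ * |(n:ℝ)|)))
    (fun i => by fun_prop) (fun k _ => (aux_summable k hC₂).mul_left _) ?_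
  · exact_mod_cast this
  · intro k n x _
    rw [norm_iteratedFDeriv_eq_norm_iteratedDeriv]
    have h1 : iteratedDeriv k (fun k : ℝ => σ n * Real.cos ((2*π*n) * k)) x
        = σ n * ((2*π*n)^k * iteratedDeriv k Real.cos ((2*π*n) * x)) := by
      rw [iteratedDeriv_const_mul_field]
      congr 1
      have := iteratedDeriv_comp_const_mul (n := k) (f := Real.cos) (Real.contDiff_cos) (2*π*n)
      simpa using congrFun this x
    rw [h1, norm_mul, norm_mul, norm_pow]
    simp only [Real.norm_eq_abs]
    rw [abs_mul (2*π), abs_of_pos (show (0:ℝ) < 2*π by positivity), mul_pow]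
    calc |σ n| * ((2*π)^k * |(n:ℝ)|^k * |iteratedDeriv k Real.cos ((2*π*n) * x)|)
        ≤ (C₁ * Real.exp (-C₂ * |(n:ℝ)|)) * ((2*π)^k * |(n:ℝ)|^k * 1) := by
          gcongr
          · exact hb n
          · exact Real.abs_iteratedDeriv_cos_le_one _ _
      _ = _ := by ring

lemma aux_main (f : ℝ → ℝ) (hf : ContDiff ℝ 2 f) (h0 : f 0 = 0)
    (hpos : ∀ k : ℝ, (∀ m : ℤ, k ≠ (m:ℝ)) → 0 < f k)
    (h2 : 0 < deriv (deriv f) 0) :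
    ∃ δ C : ℝ, 0 < δ ∧ δ < 1/2 ∧ 0 < C ∧
      ∀ k : ℝ, 0 < |k| → |k| ≤ δ →
        DifferentiableAt ℝ (fun x => Real.sqrt (f x)) k ∧
        DifferentiableAt ℝ (deriv (fun x => Real.sqrt (f x))) k ∧
        |deriv (deriv (fun x => Real.sqrt (f x))) k| ≤ C / |k| := by
  have hpos' : ∀ k : ℝ, 0 < |k| → |k| < 1 → 0 < f k := by
    intro k hk hk1
    apply hpos
    rintro m rfl
    have h1 : |m| < 1 := by exact_mod_cast hk1
    have h2 : 0 < |m| := by exact_mod_cast hk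
    omega
  have hd : Differentiable ℝ f := hf.differentiable (by norm_num)
  have hf1 : ContDiff ℝ 1 (deriv f) := by
    have : ContDiff ℝ (1+1) f := by simpa [one_add_one_eq_two] using hf
    exact (contDiff_succ_iff_deriv.1 this).2.2
  have hd1 : Differentiable ℝ (deriv f) := hf1.differentiable (by norm_num)
  have hc2 : Continuous (deriv (deriv f)) := hf1.continuous_deriv (by norm_num)
  set a := deriv (deriv f) 0 with ha
  have hmin : IsLocalMin f 0 := by
    filter_upwards [Metric.ball_mem_nhds (0:ℝ) one_pos] with x hx
    rw [h0]
    rw [Metric.mem_ball, dist_zero_right, Real.norm_eq_abs] at hx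
    rcases eq_or_ne x 0 with rfl | hx0
    · exact h0.ge
    · exact (hpos' x (abs_pos.2 hx0) hx).le
  have hd0 : deriv f 0 = 0 := hmin.deriv_eq_zero
  obtain ⟨ε, hε, hball⟩ : ∃ ε > 0, ∀ x : ℝ, |x| < ε → a/2 < deriv (deriv f) x ∧ deriv (deriv f) x < 2*a := by
    have h := hc2.continuousAt.eventually_mem (Ioo_mem_nhds (show a/2 < deriv (deriv f) 0 by linarith)
      (show deriv (deriv f) 0 < 2*a by linarith))
    obtain ⟨ε, hε, h⟩ := Metric.eventually_nhds_iff.1 h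
    exact ⟨ε, hε, fun x hx => h (by simpa using hx)⟩
  have hf'b : ∀ k : ℝ, |k| < ε → |deriv f k| ≤ 2*a*|k| := by
    intro k hk
    have := (convex_ball (0:ℝ) ε).norm_image_sub_le_of_norm_deriv_le (f := deriv f) (C := 2*a)
      (x := 0) (y := k) (fun x _ => hd1 x) (fun x hx => by
        have hx' := hball x (by simpa using hx)
        rw [Real.norm_eq_abs, abs_le]; constructor <;> linarith [hx'.1, hx'.2])
      (by simpa using hε) (by simpa using hk)
    simpa [hd0] using this
  have hfb : ∀ k : ℝ, |k| < ε → a/4*k^2 ≤ f k := by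
    set g : ℝ → ℝ := fun x => f x - a/4*x^2 with hg
    have hg1 : ∀ x, HasDerivAt g (deriv f x - a/2*x) x := by
      intro x
      convert! (hd x).hasDerivAt.sub (((hasDerivAt_id x).pow 2).const_mul (a/4)) using 1
      simp; ring
    have hg1' : deriv g = fun x => deriv f x - a/2*x := funext fun x => (hg1 x).deriv
    have hg2 : ∀ x, HasDerivAt (deriv g) (deriv (deriv f) x - a/2) x := by
      intro x
      rw [hg1']
      convert! (hd1 x).hasDerivAt.sub ((hasDerivAt_id x).const_mul (a/2)) using 1
      simp
    have hconv : ConvexOn ℝ (Metric.ball 0 ε) g := by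
      apply convexOn_of_deriv2_nonneg' (convex_ball _ _)
      · exact fun x _ => (hg1 x).differentiableAt.differentiableWithinAt
      · exact fun x _ => (hg2 x).differentiableAt.differentiableWithinAt
      · intro x hx
        have := (hball x (by simpa using hx)).1
        show 0 ≤ deriv (deriv g) x
        rw [(hg2 x).deriv]; linarith
    have hm := hconv.isMinOn_of_rightDeriv_eq_zero (x := 0)
      (by rw [Metric.isOpen_ball.interior_eq]; simpa using hε)
      (by
        rw [(hg1 0).hasDerivWithinAt.derivWithin (uniqueDiffWithinAt_Ioi 0)]
        simp [hd0])
    intro k hk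
    have := hm (show k ∈ Metric.ball 0 ε by simpa using hk)
    simp only [Set.mem_ofPred_eq, hg, h0] at this
    linarith
  set b := √a / 2 with hb
  have hbpos : 0 < b := by positivity
  have hb2 : b^2 = a/4 := by rw [hb, div_pow, Real.sq_sqrt h2.le]; norm_num
  refine ⟨min (ε/2) (1/4), a/b + a^2/b^3, by positivity,
    lt_of_le_of_lt (min_le_right _ _) (by norm_num), by positivity, ?_⟩
  intro k hk0 hkδ
  have hkε : |k| < ε := by linarith [min_le_left (ε/2) (1/4)]
  have hk1 : |k| < 1 := by linarith [min_le_right (ε/2) (1/4)]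
  have hfk := hpos' k hk0 hk1
  have hfirst : ∀ x, 0 < f x → HasDerivAt (fun x => √(f x)) (deriv f x / (2 * √(f x))) x :=
    fun x hx => (hd x).hasDerivAt.sqrt hx.ne'
  have hev : deriv (fun x => √(f x)) =ᶠ[nhds k] fun x => deriv f x / (2 * √(f x)) := by
    filter_upwards [(hd k).continuousAt.eventually_mem (Ioi_mem_nhds hfk)] with x hx
    exact (hfirst x hx).deriv
  have hs0 : 0 < √(f k) := Real.sqrt_pos.2 hfk
  have hsecond := ((hd1 k).hasDerivAt.div ((hfirst k hfk).const_mul 2) (by positivity)).congr_of_eventuallyEq hev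
  refine ⟨(hfirst k hfk).differentiableAt, hsecond.differentiableAt, ?_⟩
  rw [hsecond.deriv]
  have hs : b * |k| ≤ √(f k) := by
    apply Real.le_sqrt_of_sq_le
    rw [mul_pow, sq_abs, hb2]; exact hfb k hkε
  have hA := hf'b k hkε
  have hB : |deriv (deriv f) k| ≤ 2*a := by
    have hx' := hball k hkε
    rw [abs_le]; constructor <;> linarith [hx'.1, hx'.2]
  generalize √(f k) = s at *
  generalize deriv f k = p at *
  generalize deriv (deriv f) k = q at *
  have e : (q * (2 * s) - p * (2 * (p / (2 * s)))) / (2 * s)^2 = q / (2*s) - p^2/(4*s^3) := by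
    field_simp
    ring
  rw [e]
  calc |q / (2*s) - p^2/(4*s^3)| ≤ |q / (2*s)| + |p^2/(4*s^3)| := abs_sub _ _
    _ = |q| / (2*s) + |p|^2/(4*s^3) := by
        rw [abs_div, abs_div, abs_pow, abs_of_pos (show 0 < 2*s by positivity),
          abs_of_pos (show 0 < 4*s^3 by positivity)]
    _ ≤ (2*a) / (2*(b*|k|)) + (2*a*|k|)^2/(4*(b*|k|)^3) := by gcongr
    _ = (a/b + a^2/b^3) / |k| := by field_simp; ring

/-- **Blow-up of `ω''` near the origin (no-pinning case):** there exist `δ ∈ (0,1/2)` and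
`C > 0` such that `ω = √σ̂` is twice differentiable at every `k` with `0 < |k| ≤ δ` and
`|ω''(k)| ≤ C/|k|` for all such `k`. -/
theorem omega_second_deriv_bound
    (σ : ℤ → ℝ) (σhat : ℝ → ℝ)
    (hσeven : ∀ n : ℤ, σ (-n) = σ n)
    (hσne : ∃ n : ℤ, n ≠ 0 ∧ σ n ≠ 0)
    (hσdecay : ∃ C₁ C₂ : ℝ, 0 < C₁ ∧ 0 < C₂ ∧
      ∀ n : ℤ, |σ n| ≤ C₁ * Real.exp (-C₂ * |(n:ℝ)|))
    (hσhat : ∀ k : ℝ, HasSum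
      (fun n : ℤ => (σ n : ℂ) * Complex.exp (-(2*(π:ℂ)*Complex.I) * k * n))
      ((σhat k : ℂ)))
    (h0 : σhat 0 = 0)
    (hpos : ∀ k : ℝ, (∀ m : ℤ, k ≠ (m:ℝ)) → 0 < σhat k)
    (h2 : 0 < deriv (deriv σhat) 0) :
    ∃ δ C : ℝ, 0 < δ ∧ δ < 1/2 ∧ 0 < C ∧
      ∀ k : ℝ, 0 < |k| → |k| ≤ δ →
        DifferentiableAt ℝ (fun x => Real.sqrt (σhat x)) k ∧
        DifferentiableAt ℝ (deriv (fun x => Real.sqrt (σhat x))) k ∧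
        |deriv (deriv (fun x => Real.sqrt (σhat x))) k| ≤ C / |k| := by
  exact aux_main σhat (aux_contDiff σ σhat hσdecay hσhat) h0 hpos h2
end

section
/- (Conservation of local momentum and kinetic energy by the controlled vector field.) Let N ≥ 1 and M : ℤ → ℝ satisfy M(d) + M(−d) = 0 for all d and M(d) = 0 for |d| > N. Then for every α : ℤ → ℝ and every n ∈ ℤ: (i) ∑_{1≤|d|≤N} M(d)(α_n − α_{n+d}) + ∑_{1≤|d|≤N} M(d) α_{n+d} = 0, and (ii) ∑_{1≤|d|≤N} M(d)(α_n − α_{n+d}) α_{n−d} + (∑_{1≤|d|≤N} M(d) α_{n+d}) α_n = 0. Equivalently, the vector field λ_n^{M} = ∑_{1≤|d|≤N} M(d)(α_n − α_{n+d}) ∂/∂α_{n−d} + (∑_{1≤|d|≤N} M(d) α_{n+d}) ∂/∂α_n annihilates the local momentum ∑_{|d'|≤N} α_{n+d'} and the local kinetic energy ∑_{|d'|≤N} α_{n+d'}². -/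
open Finset

/-- The sum of an odd function over the punctured symmetric interval vanishes. -/
theorem sum_odd_erase (N : ℕ) (f : ℤ → ℝ) (hf : ∀ d, f (-d) = - f d) :
    ∑ d ∈ (Finset.Icc (-(N:ℤ)) (N:ℤ)).erase 0, f d = 0 := by
  have h : ∑ d ∈ (Finset.Icc (-(N:ℤ)) (N:ℤ)).erase 0, f d
      = ∑ d ∈ (Finset.Icc (-(N:ℤ)) (N:ℤ)).erase 0, - f d := by
    refine Finset.sum_bij' (fun d _ => -d) (fun d _ => -d) ?_ ?_ ?_ ?_ ?_
    · intro d hd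
      simp only [Finset.mem_erase, Finset.mem_Icc] at hd ⊢
      omega
    · intro d hd
      simp only [Finset.mem_erase, Finset.mem_Icc] at hd ⊢
      omega
    · intro d _
      simp
    · intro d _
      simp
    · intro d _
      simp [hf]
  rw [Finset.sum_neg_distrib] at h
  linarith

/-- **Conservation of local momentum and kinetic energy by the controlled vector field.**
Let `N ≥ 1` and `M : ℤ → ℝ` be odd (`M(d) + M(−d) = 0`) with `M(d) = 0` for `|d| > N`.
Then for every configuration of momenta `α` and every site `n`:
(i) `∑_{1≤|d|≤N} M(d)(α_n − α_{n+d}) + ∑_{1≤|d|≤N} M(d) α_{n+d} = 0`, and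
(ii) `∑_{1≤|d|≤N} M(d)(α_n − α_{n+d}) α_{n−d} + (∑_{1≤|d|≤N} M(d) α_{n+d}) α_n = 0`;
i.e. the vector field `λ_n^M` annihilates the local momentum `∑_{|d'|≤N} α_{n+d'}` and
the local kinetic energy `∑_{|d'|≤N} α_{n+d'}²`. -/
theorem lambda_conserves_momentum_energy (N : ℕ) (hN : 1 ≤ N) (M : ℤ → ℝ)
    (hM1 : ∀ d : ℤ, M d + M (-d) = 0)
    (hMN : ∀ d : ℤ, (N:ℤ) < |d| → M d = 0)
    (α : ℤ → ℝ) (n : ℤ) :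
    (∑ d ∈ (Finset.Icc (-(N:ℤ)) (N:ℤ)).erase 0, M d * (α n - α (n+d))
        + ∑ d ∈ (Finset.Icc (-(N:ℤ)) (N:ℤ)).erase 0, M d * α (n+d) = 0) ∧
    (∑ d ∈ (Finset.Icc (-(N:ℤ)) (N:ℤ)).erase 0, M d * (α n - α (n+d)) * α (n-d)
        + (∑ d ∈ (Finset.Icc (-(N:ℤ)) (N:ℤ)).erase 0, M d * α (n+d)) * α n = 0) := by
  have hM : ∀ d, M (-d) = - M d := fun d => by linarith [hM1 d]
  constructor
  · rw [← Finset.sum_add_distrib]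
    apply sum_odd_erase N (fun d => M d * (α n - α (n+d)) + M d * α (n+d))
    intro d
    simp only [hM]
    ring
  · rw [Finset.sum_mul, ← Finset.sum_add_distrib]
    apply sum_odd_erase N (fun d => M d * (α n - α (n+d)) * α (n-d) + M d * α (n+d) * α n)
    intro d
    simp only [hM, sub_neg_eq_add, ← sub_eq_add_neg]
    ring
end
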